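/- Σ_{p prime} 1/(p·(√p − 1)) ≤ 2.12. -/

import Mathlib

/-- bitwise integer square root (lower bound) -/
def sqLow (X : ℕ) : ℕ → ℕ → ℕ
  | 0, s => s
  | k + 1, s => sqLow X k (bif Nat.ble ((s + 2 ^ k) * (s + 2 ^ k)) X then s + 2 ^ k else s)

theorem sqLow_le (X k : ℕ) : ∀ s, s * s ≤ X → sqLow X k s * sqLow X k s ≤ X := by
  induction k with
  | zero => intro s h; simpa [sqLow] using h
  | succ k ih =>
    intro s h
    rw [sqLow]
    apply ih
    cases hb : Nat.ble ((s + 2 ^ k) * (s + 2 ^ k)) X with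
    | false => simpa using h
    | true => simpa using Nat.le_of_ble_eq_true hb

/-- trial division: `true` if some listed `q < n` divides `n` -/
def sieved (n : ℕ) : List ℕ → Bool
  | [] => false
  | q :: l => bif (Nat.beq (n % q) 0 && Nat.blt q n) then true else sieved n l

theorem sieved_not_prime (n : ℕ) (l : List ℕ) (hl : ∀ q ∈ l, 2 ≤ q) (h : sieved n l = true) :
    ¬ n.Prime := by
  induction l with
  | nil => simp [sieved] at h
  | cons q l ih =>
    rw [sieved] at h
    cases hb : (Nat.beq (n % q) 0 && Nat.blt q n) with
    | false =>
      rw [hb] at h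
      exact ih (fun r hr => hl r (List.mem_cons_of_mem _ hr)) h
    | true =>
      rw [Bool.and_eq_true] at hb
      have h1 : n % q = 0 := Nat.eq_of_beq_eq_true hb.1
      have h2 : q < n := Nat.le_of_ble_eq_true hb.2
      have h3 := hl q List.mem_cons_self
      exact Nat.not_prime_of_dvd_of_lt (Nat.dvd_of_mod_eq_zero h1) h3 h2

def smallPrimes : List ℕ := [2, 3, 5, 7, 11, 13, 17, 19, 23, 29, 31, 37, 41, 43, 47, 53, 59, 61]

def termOf (n s : ℕ) : ℕ := 10 ^ 16 / (n * (s - 10 ^ 6)) + 1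

/-- upper bound for `10^10 / (n (√n - 1))` on primes `< 4096` -/
def termUp (n : ℕ) : ℕ :=
  bif Nat.ble n 1 then 0 else
  bif sieved n smallPrimes then 0 else termOf n (sqLow (n * 10 ^ 12) 26 0)

noncomputable def hterm (n : ℕ) : ℝ :=
  if n.Prime then 1 / ((n : ℝ) * (Real.sqrt n - 1)) else 0

theorem hterm_nonneg (n : ℕ) : 0 ≤ hterm n := by
  unfold hterm
  split_ifs with h
  · have : (1 : ℝ) ≤ Real.sqrt n := by
      rw [Real.one_le_sqrt]
      exact_mod_cast h.one_lt.le
    have : (0 : ℝ) ≤ Real.sqrt n - 1 := by linarith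
    positivity
  · exact le_rfl

theorem termOf_bound (n s : ℕ) (hn : 0 < n) (hs : s * s ≤ n * 10 ^ 12) (h6 : 10 ^ 6 < s) :
    1 / ((n : ℝ) * (Real.sqrt n - 1)) ≤ (termOf n s : ℝ) / 10 ^ 10 := by
  have hn' : (0 : ℝ) < n := by exact_mod_cast hn
  have h6' : (10 ^ 6 : ℝ) < s := by exact_mod_cast h6
  have h1 : (s : ℝ) / 10 ^ 6 ≤ Real.sqrt n := by
    apply Real.le_sqrt_of_sq_le
    have : (s : ℝ) * s ≤ n * 10 ^ 12 := by exact_mod_cast hs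
    rw [div_pow, div_le_iff₀ (by positivity)]
    nlinarith
  have hpos : (0 : ℝ) < n * (s - 10 ^ 6) := mul_pos hn' (by linarith)
  have h2 : (10 : ℝ) ^ 16 / (n * (s - 10 ^ 6)) ≤ termOf n s := by
    have h3 : 10 ^ 16 < (10 ^ 16 / (n * (s - 10 ^ 6)) + 1) * (n * (s - 10 ^ 6)) := by
      rw [mul_comm]
      exact Nat.lt_mul_div_succ _ (Nat.mul_pos hn (by omega))
    rw [div_le_iff₀ hpos]
    have h4 : (10 ^ 16 : ℝ) < (termOf n s : ℝ) * (n * ((s - 10 ^ 6 : ℕ) : ℝ)) := by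
      unfold termOf
      exact_mod_cast h3
    rw [Nat.cast_sub h6.le] at h4
    push_cast at h4
    norm_num at h4 ⊢
    exact h4.le
  calc 1 / ((n : ℝ) * (Real.sqrt n - 1)) ≤ 1 / ((n : ℝ) * (s / 10 ^ 6 - 1)) := by
        apply one_div_le_one_div_of_le
        · apply mul_pos hn'
          rw [sub_pos, lt_div_iff₀ (by positivity)]
          linarith
        · gcongr
    _ = (10 : ℝ) ^ 16 / (n * (s - 10 ^ 6)) / 10 ^ 10 := by
        have : (s : ℝ) - 10 ^ 6 ≠ 0 := by linarith
        have h7 : (s : ℝ) / 10 ^ 6 - 1 = (s - 10 ^ 6) / 10 ^ 6 := by field_simp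
        rw [h7]
        field_simp
    _ ≤ _ := by gcongr

/-- check that the square root is usable -/
def okTerm (n : ℕ) : Bool := Nat.ble n 1 || sieved n smallPrimes ||
  Nat.blt (10 ^ 6) (sqLow (n * 10 ^ 12) 26 0)

theorem hterm_le (n : ℕ) (hok : okTerm n = true) : hterm n ≤ (termUp n : ℝ) / 10 ^ 10 := by
  unfold hterm
  split_ifs with h
  · have h1 : Nat.ble n 1 = false := by
      have := h.two_le
      cases hb : Nat.ble n 1 with
      | false => rfl
      | true => have := Nat.le_of_ble_eq_true hb; omega
    have h2 : sieved n smallPrimes = false := by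
      cases hb : sieved n smallPrimes with
      | false => rfl
      | true => exact absurd h (sieved_not_prime n _ (by decide) hb)
    have h3 : 10 ^ 6 < sqLow (n * 10 ^ 12) 26 0 := by
      unfold okTerm at hok
      rw [h1, h2] at hok
      simp only [Bool.false_or] at hok
      exact Nat.le_of_ble_eq_true hok
    unfold termUp
    rw [h1, h2]
    exact termOf_bound n _ h.pos (sqLow_le _ _ _ (by simp)) h3
  · positivity

/-- binary-splitting sum -/
def bsum : ℕ → ℕ → ℕ
  | 0, a => termUp a
  | k + 1, a => bsum k a + bsum k (a + 2 ^ k)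

def ball : ℕ → ℕ → Bool
  | 0, a => okTerm a
  | k + 1, a => ball k a && ball k (a + 2 ^ k)

theorem bsum_bound (k : ℕ) : ∀ a, ball k a = true →
    ∑ i ∈ Finset.range (2 ^ k), hterm (a + i) ≤ (bsum k a : ℝ) / 10 ^ 10 := by
  induction k with
  | zero => intro a h; simpa [bsum] using hterm_le a h
  | succ k ih =>
    intro a h
    rw [ball, Bool.and_eq_true] at h
    have e : 2 ^ (k + 1) = 2 ^ k + 2 ^ k := by ring
    rw [e, Finset.sum_range_add, bsum]
    have h1 := ih a h.1
    have h2 := ih _ h.2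
    push_cast
    rw [add_div]
    simp only [← add_assoc] 
    exact add_le_add h1 h2

theorem ball_ok : ball 12 0 = true := by decide +kernel

theorem bsum_ok : Nat.ble (bsum 12 0) 21090000000 = true := by decide +kernel

theorem base_bound : ∑ i ∈ Finset.range 4093, hterm i ≤ 2.109 := by
  have h := bsum_bound 12 0 ball_ok
  simp only [zero_add] at h
  have h2 : (bsum 12 0 : ℝ) ≤ 21090000000 := by
    exact_mod_cast Nat.le_of_ble_eq_true bsum_ok
  have h3 : ∑ i ∈ Finset.range 4093, hterm i ≤ ∑ i ∈ Finset.range (2 ^ 12), hterm i :=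
    Finset.sum_le_sum_of_subset_of_nonneg (Finset.range_mono (by norm_num))
      (fun i _ _ => hterm_nonneg i)
  have h4 : (bsum 12 0 : ℝ) / 10 ^ 10 ≤ 2.109 := by
    generalize (bsum 12 0 : ℝ) = B at h2
    rw [div_le_iff₀ (by positivity)]
    norm_num
    exact h2
  exact h3.trans (h.trans h4)

theorem hterm_le_of_le (b n : ℕ) (hb : 2 ≤ b) (hbn : b ≤ n) :
    hterm n ≤ 1 / ((b : ℝ) * (Real.sqrt b - 1)) := by
  have h1 : (1 : ℝ) < Real.sqrt b := by
    rw [Real.lt_sqrt (by norm_num)]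
    have : (2 : ℝ) ≤ b := by exact_mod_cast hb
    linarith
  have h0 : (0 : ℝ) < b := by exact_mod_cast (by omega : 0 < b)
  have h2 : (b : ℝ) ≤ n := by exact_mod_cast hbn
  unfold hterm
  split_ifs
  · apply one_div_le_one_div_of_le
    · exact mul_pos h0 (by linarith)
    · have := Real.sqrt_le_sqrt h2
      apply mul_le_mul h2 (by linarith) (by linarith) (by linarith)
  · exact (one_div_pos.mpr (mul_pos h0 (by linarith))).le

theorem step_real (u v : ℝ) (hu : 0 < u) (huv : v ^ 2 = u ^ 2 + 6) (hv : 60 ≤ v) :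
    2 * (1 / (v ^ 2 * (v - 1))) + 0.68 / v ≤ 0.68 / u := by
  have hv0 : 0 < v := by linarith
  have hle : u ≤ v := by nlinarith
  have e : 0.68 / u - 0.68 / v = 4.08 / (u * v * (u + v)) := by
    field_simp
    nlinarith
  have h1 : 2.04 / v ^ 3 ≤ 4.08 / (u * v * (u + v)) := by
    rw [div_le_div_iff₀ (by positivity) (by positivity)]
    have : u * (u + v) ≤ 2 * v ^ 2 := by nlinarith
    have := mul_le_mul_of_nonneg_left this hv0.le
    nlinarith
  have h2 : 2 * (1 / (v ^ 2 * (v - 1))) ≤ 2.04 / v ^ 3 := by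
    rw [mul_one_div, div_le_div_iff₀ (mul_pos (by positivity) (by linarith)) (by positivity)]
    have : 0 ≤ v ^ 2 * (2.04 * (v - 1) - 2 * v) := mul_nonneg (by positivity) (by linarith)
    nlinarith
  linarith

theorem hterm_zero (n d : ℕ) (hd : d ∣ n) (h2 : 2 ≤ d) (hn : d < n) : hterm n = 0 := by
  unfold hterm
  rw [if_neg (Nat.not_prime_of_dvd_of_lt hd h2 hn)]

theorem tail_bound (m : ℕ) :
    ∑ i ∈ Finset.range (6 * m + 4093), hterm i + 0.68 / Real.sqrt ((6 * m + 4087 : ℕ) : ℝ)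
      ≤ 2.12 := by
  induction m with
  | zero =>
    have h := base_bound
    have h1 : (63 : ℝ) ≤ Real.sqrt ((6 * 0 + 4087 : ℕ) : ℝ) := by
      apply Real.le_sqrt_of_sq_le
      norm_num
    have h2 : 0.68 / Real.sqrt ((6 * 0 + 4087 : ℕ) : ℝ) ≤ 0.68 / 63 := by gcongr
    have h3 : (0.68 / 63 : ℝ) ≤ 0.011 := by norm_num
    have h5 : ∑ i ∈ Finset.range (6 * 0 + 4093), hterm i ≤ 2.109 := h
    refine (add_le_add h5 (h2.trans h3)).trans ?_
    norm_num
  | succ m ih =>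
    have e : 6 * (m + 1) + 4093 = 6 * m + 4093 + 1 + 1 + 1 + 1 + 1 + 1 := by ring
    have e2 : 6 * (m + 1) + 4087 = 6 * m + 4093 := by ring
    rw [e, e2]
    rw [Finset.sum_range_succ, Finset.sum_range_succ, Finset.sum_range_succ,
      Finset.sum_range_succ, Finset.sum_range_succ, Finset.sum_range_succ]
    rw [hterm_zero (6 * m + 4093 + 1) 2 (by omega) le_rfl (by omega),
      hterm_zero (6 * m + 4093 + 1 + 1) 3 (by omega) (by norm_num) (by omega),
      hterm_zero (6 * m + 4093 + 1 + 1 + 1) 2 (by omega) (by norm_num) (by omega),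
      hterm_zero (6 * m + 4093 + 1 + 1 + 1 + 1 + 1) 2 (by omega) (by norm_num) (by omega)]
    have h1 := hterm_le_of_le (6 * m + 4093) (6 * m + 4093) (by omega) le_rfl
    have h2 := hterm_le_of_le (6 * m + 4093) (6 * m + 4093 + 1 + 1 + 1 + 1) (by omega) (by omega)
    have hsq : Real.sqrt ((6 * m + 4093 : ℕ) : ℝ) ^ 2 = ((6 * m + 4093 : ℕ) : ℝ) :=
      Real.sq_sqrt (Nat.cast_nonneg _)
    have hsq2 : Real.sqrt ((6 * m + 4087 : ℕ) : ℝ) ^ 2 = ((6 * m + 4087 : ℕ) : ℝ) :=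
      Real.sq_sqrt (Nat.cast_nonneg _)
    have h3 := step_real (Real.sqrt ((6 * m + 4087 : ℕ) : ℝ)) (Real.sqrt ((6 * m + 4093 : ℕ) : ℝ))
      (Real.sqrt_pos.mpr (by positivity)) (by rw [hsq, hsq2]; push_cast; ring)
      (by
        apply Real.le_sqrt_of_sq_le
        push_cast
        have : (0 : ℝ) ≤ m := Nat.cast_nonneg m
        linarith)
    rw [hsq] at h3
    linarith

theorem sum_prime_inv_mul_sqrt_sub_one_le :
    ∑' p : Nat.Primes, 1 / ((p : ℝ) * (Real.sqrt p - 1)) ≤ 2.12 := by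
  apply tsum_le_of_sum_le' (by norm_num)
  intro s
  have h1 : ∑ p ∈ s, 1 / ((p : ℝ) * (Real.sqrt p - 1))
      = ∑ n ∈ s.map ⟨fun p : Nat.Primes => (p : ℕ), Subtype.val_injective⟩, hterm n := by
    rw [Finset.sum_map]
    apply Finset.sum_congr rfl
    intro p _
    have hp : hterm (p : ℕ) = 1 / (((p : ℕ) : ℝ) * (Real.sqrt (p : ℕ) - 1)) := if_pos p.2
    exact hp.symm
  rw [h1]
  generalize s.map _ = t
  obtain ⟨N, hN⟩ := t.exists_nat_subset_range
  have h2 : ∑ n ∈ t, hterm n ≤ ∑ n ∈ Finset.range (6 * N + 4093), hterm n :=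
    Finset.sum_le_sum_of_subset_of_nonneg (hN.trans (Finset.range_mono (by omega)))
      (fun i _ _ => hterm_nonneg i)
  have h3 := tail_bound N
  have h4 : 0 ≤ 0.68 / Real.sqrt ((6 * N + 4087 : ℕ) : ℝ) := by positivity
  linarith
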